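/- Let H be an elementary abelian 2-hypergroup, G a closed subset of H, and r ∈ Thick(G). Then Aut(⟨r⟩) ≅ S_{s(r)} and Aut(O^ϑ(G)) ≅ S_{s(G)}, where S_n denotes the symmetric group on n letters. In particular, Aut(O^ϑ(H)) ≅ S_{p♯}, where p♯ is the number of thick involutions among the defining involutions of H. -/

import Mathlib

namespace HyperPaper

/-- A hypergroup: hypermultiplication `hmul`, inversion `star`, identity `e`,
satisfying (H1) associativity, (H2) unique two-sided identity, (H3) exchange conditions. -/
structure Hypergroup (H : Type*) where
  hmul : H → H → Set H
  star : H → H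
  e : H
  idl : ∀ p, hmul e p = {p}
  idr : ∀ p, hmul p e = {p}
  e_unique : ∀ e' : H, (∀ p, hmul e' p = {p} ∧ hmul p e' = {p}) → e' = e
  assoc : ∀ p q r : H, (⋃ x ∈ hmul p q, hmul x r) = ⋃ x ∈ hmul q r, hmul p x
  h3l : ∀ p q r : H, p ∈ hmul q r ↔ q ∈ hmul p (star r)
  h3r : ∀ p q r : H, p ∈ hmul q r ↔ r ∈ hmul (star q) p

variable {H : Type*}

namespace Hypergroup

/-- Product of two subsets: FG = {a : ∃ b ∈ F, c ∈ G, a ∈ bc}. -/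
def smul (hg : Hypergroup H) (F G : Set H) : Set H :=
  {a | ∃ b ∈ F, ∃ c ∈ G, a ∈ hg.hmul b c}

/-- Closed subset: nonempty and G*G ⊆ G. -/
def IsClosed (hg : Hypergroup H) (G : Set H) : Prop :=
  G.Nonempty ∧ hg.smul (hg.star '' G) G ⊆ G

/-- Thin element: p*p = {e}. -/
def IsThin (hg : Hypergroup H) (p : H) : Prop := hg.hmul (hg.star p) p = {hg.e}

/-- Thick element: not thin. -/
def IsThick (hg : Hypergroup H) (p : H) : Prop := ¬ hg.IsThin p

/-- Involution: p ≠ e and {e, p} is closed. -/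
def IsInvolution (hg : Hypergroup H) (p : H) : Prop :=
  p ≠ hg.e ∧ hg.IsClosed {hg.e, p}

/-- ⟨G⟩: smallest closed subset containing G. -/
def gen (hg : Hypergroup H) (G : Set H) : Set H := ⋂₀ {C | hg.IsClosed C ∧ G ⊆ C}

/-- O_ϑ(G): the thin elements of H lying in G. -/
def Othin (hg : Hypergroup H) (G : Set H) : Set H := {p ∈ G | hg.IsThin p}

/-- F is a strongly normal closed subset of G: p*Fp ⊆ F ⊆ G for all p ∈ G. -/
def IsStronglyNormal (hg : Hypergroup H) (F G : Set H) : Prop :=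
  hg.IsClosed F ∧ hg.IsClosed G ∧ F ⊆ G ∧
    ∀ p ∈ G, hg.smul (hg.smul {hg.star p} F) {p} ⊆ F

/-- O^ϑ(G): intersection of all strongly normal closed subsets of ⟨G⟩. -/
def Osup (hg : Hypergroup H) (G : Set H) : Set H :=
  ⋂₀ {F | hg.IsStronglyNormal F (hg.gen G)}

/-- F is a normal closed subset of G. -/
def IsNormal (hg : Hypergroup H) (F G : Set H) : Prop :=
  hg.IsClosed F ∧ hg.IsClosed G ∧ F ⊆ G ∧ ∀ p ∈ G, hg.smul F {p} = hg.smul {p} F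

/-- Product of a list of subsets (empty product is {e}). -/
def listProd (hg : Hypergroup H) : List (Set H) → Set H
  | [] => {hg.e}
  | a :: l => hg.smul a (hg.listProd l)

/-- Product r_1 r_2 ⋯ r_n of a family of elements. -/
def famProd (hg : Hypergroup H) {n : ℕ} (r : Fin n → H) : Set H :=
  hg.listProd ((List.finRange n).map fun i => ({r i} : Set H))

/-- Ĝ_i: the product of the G_j with j ≠ i. -/
def cofactor (hg : Hypergroup H) {n : ℕ} (G : Fin n → Set H) (i : Fin n) : Set H :=
  hg.listProd (((List.finRange n).filter fun j => decide (j ≠ i)).map G)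

/-- H is the direct product of the normal closed subsets G_1, …, G_n. -/
def IsDirectProduct (hg : Hypergroup H) {n : ℕ} (G : Fin n → Set H) : Prop :=
  (∀ i, hg.IsNormal (G i) Set.univ) ∧
  (∀ i, hg.smul (G i) (hg.cofactor G i) = Set.univ) ∧
  (∀ i, G i ∩ hg.cofactor G i = {hg.e})

/-- r : Fin n → H is a decomposition of x with respect to the family G. -/
def IsDecomp (hg : Hypergroup H) {n : ℕ} (G : Fin n → Set H) (x : H) (r : Fin n → H) : Prop :=
  (∀ i, r i ∈ G i) ∧ x ∈ hg.famProd r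

/-- The support of x: the elements ≠ e appearing in the decomposition of x. -/
def dsupport (hg : Hypergroup H) {n : ℕ} (G : Fin n → Set H) (x : H) : Set H :=
  {y | y ≠ hg.e ∧ ∃ r, hg.IsDecomp G x r ∧ y ∈ Set.range r}

/-- The cover of x: the product r_1r_2⋯r_n for the decomposition of x. -/
def dcover (hg : Hypergroup H) {n : ℕ} (G : Fin n → Set H) (x : H) : Set H :=
  {y | ∃ r, hg.IsDecomp G x r ∧ y ∈ hg.famProd r}

/-- x is constrained: its cover equals {x}. -/
def IsConstrained (hg : Hypergroup H) {n : ℕ} (G : Fin n → Set H) (x : H) : Prop :=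
  hg.dcover G x = {x}

/-- r_2(G): the largest 2-rank of a thin closed subset of H contained in G
(equivalently, the largest k such that G contains a thin symmetric closed subset
of 2^k elements, which corresponds to an elementary abelian 2-group of 2-rank k). -/
noncomputable def rank2 (hg : Hypergroup H) (G : Set H) : ℕ :=
  sSup {k | ∃ U : Set H, hg.IsClosed U ∧ U ⊆ G ∧ (∀ u ∈ U, hg.IsThin u) ∧
    (∀ u ∈ U, hg.star u = u) ∧ U.ncard = 2 ^ k}

/-- F is a minimal generating subset of G. -/
def IsMinGen (hg : Hypergroup H) (G F : Set H) : Prop :=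
  F ⊆ G ∧ hg.gen F = G ∧ ∀ p ∈ F, hg.gen (F \ {p}) ≠ G

/-- The dimension of G: the smallest cardinality of a minimal generating subset. -/
noncomputable def dimension (hg : Hypergroup H) (G : Set H) : ℕ :=
  sInf {k | ∃ F : Set H, hg.IsMinGen G F ∧ F.Finite ∧ F.ncard = k}

/-- [F, G] = ⟨{a : ∃ b ∈ F, c ∈ G, a ∈ b*c*bc}⟩. -/
def commSet (hg : Hypergroup H) (F G : Set H) : Set H :=
  hg.gen {a | ∃ b ∈ F, ∃ c ∈ G,
    a ∈ hg.smul (hg.smul (hg.smul {hg.star b} {hg.star c}) {b}) {c}}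

/-- derived G k = G^{(k+1)}: G^{(1)} = G, G^{(r)} = [G^{(r-1)}, G]. -/
def derived (hg : Hypergroup H) (G : Set H) : ℕ → Set H
  | 0 => G
  | k + 1 => hg.commSet (hg.derived G k) G

/-- G is nilpotent: G^{(r)} = {e} for some r. -/
def IsNilpotent (hg : Hypergroup H) (G : Set H) : Prop :=
  ∃ k : ℕ, hg.derived G k = {hg.e}

/-- G is a residually thin closed subset: there is a chain {e} = F_1, …, F_n = G of
pairwise distinct closed subsets, each strongly normal in the next. -/
def IsResiduallyThin (hg : Hypergroup H) (G : Set H) : Prop :=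
  ∃ (m : ℕ) (F : Fin (m + 1) → Set H), Function.Injective F ∧
    F 0 = {hg.e} ∧ F (Fin.last m) = G ∧
    ∀ i : Fin m, hg.IsStronglyNormal (F i.castSucc) (F i.succ)

/-- x^k as a subset: x^0 = {e}, x^{k+1} = x^k · x. -/
def spow (hg : Hypergroup H) (x : H) : ℕ → Set H
  | 0 => {hg.e}
  | k + 1 => hg.smul (hg.spow x k) {x}

/-- F is a maximal closed subset of G. -/
def IsMaximalClosed (hg : Hypergroup H) (F G : Set H) : Prop :=
  hg.IsClosed F ∧ hg.IsClosed G ∧ F ⊆ G ∧ F ≠ G ∧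
    ∀ E : Set H, hg.IsClosed E → F ⊆ E → E ⊆ G → E = F ∨ E = G

/-- The Frattini closed subset of G: the intersection (inside G) of all maximal
closed subsets of G. -/
def frattini (hg : Hypergroup H) (G : Set H) : Set H :=
  G ∩ ⋂₀ {F | hg.IsMaximalClosed F G}

/-- α is an isomorphism from the closed subset F to the closed subset G. -/
def IsIso (hg : Hypergroup H) (F G : Set H) (α : H → H) : Prop :=
  Set.BijOn α F G ∧ α hg.e = hg.e ∧
    ∀ p ∈ F, ∀ q ∈ F, α '' hg.hmul p q = hg.hmul (α p) (α q)

/-- F ≃ G: there is an isomorphism from F to G. -/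
def Isomorphic (hg : Hypergroup H) (F G : Set H) : Prop := ∃ α : H → H, hg.IsIso F G α

/-- Aut(G): the automorphism group of G, realized as the subgroup of permutations of G
that fix e and preserve the hypermultiplication. -/
def autGroup (hg : Hypergroup H) (G : Set H) : Subgroup (Equiv.Perm G) where
  carrier := {σ | (∀ x : G, (x : H) = hg.e → ((σ x : H)) = hg.e) ∧
    ∀ p q x : G, (x : H) ∈ hg.hmul p q ↔ ((σ x : H)) ∈ hg.hmul (σ p) (σ q)}
  one_mem' := by
    constructor
    · intro x hx; simpa using hx
    · intro p q x; simp
  mul_mem' := by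
    rintro σ τ ⟨he1, hm1⟩ ⟨he2, hm2⟩
    refine ⟨fun x hx => ?_, fun p q x => ?_⟩
    · simpa using he1 _ (he2 x hx)
    · simpa using (hm2 p q x).trans (hm1 (τ p) (τ q) (τ x))
  inv_mem' := by
    rintro σ ⟨he, hm⟩
    refine ⟨fun x hx => ?_, fun p q x => ?_⟩
    · have h2 : σ x = x := Subtype.ext ((he x hx).trans hx.symm)
      have h3 : σ⁻¹ x = x := by
        conv_lhs => rw [← h2]
        simp
      rw [h3]; exact hx
    · have h := hm (σ⁻¹ p) (σ⁻¹ q) (σ⁻¹ x)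
      simpa using h.symm

end Hypergroup

/-- An elementary abelian 2-hypergroup: a hypergroup that is the constrained direct
product of the closed subsets ⟨q_1⟩, …, ⟨q_n⟩ generated by involutions q_1, …, q_n. -/
structure EA2Data (H : Type*) where
  hg : Hypergroup H
  n : ℕ
  q : Fin n → H
  invol : ∀ i, hg.IsInvolution (q i)
  dp : hg.IsDirectProduct fun i => hg.gen {q i}
  constrained : ∀ x : H, hg.IsConstrained (fun i => hg.gen {q i}) x

namespace EA2Data

/-- The family ⟨q_1⟩, …, ⟨q_n⟩. -/
def fam (E : EA2Data H) : Fin E.n → Set H := fun i => E.hg.gen {E.q i}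

/-- The support of x. -/
def support (E : EA2Data H) (x : H) : Set H := E.hg.dsupport E.fam x

/-- Thick(F): externally thick elements of H lying in F. -/
def ThickIn (E : EA2Data H) (F : Set H) : Set H :=
  {x ∈ F | x = E.hg.e ∨ ∀ y ∈ E.support x, E.hg.IsThick y}

/-- Thin(F): externally thin elements of H lying in F. -/
def ThinIn (E : EA2Data H) (F : Set H) : Set H :=
  {x ∈ F | x = E.hg.e ∨ ∀ y ∈ E.support x, E.hg.IsThin y}

/-- The (unique) pair (x⁺, x⁻) with x⁺ ∈ Thick(H), x⁻ ∈ Thin(H), x⁺x⁻ = {x}. -/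
noncomputable def pm (E : EA2Data H) (x : H) : H × H :=
  @Classical.epsilon (H × H) ⟨(E.hg.e, E.hg.e)⟩ fun z =>
    z.1 ∈ E.ThickIn Set.univ ∧ z.2 ∈ E.ThinIn Set.univ ∧ E.hg.hmul z.1 z.2 = {x}

/-- x⁺. -/
noncomputable def plus (E : EA2Data H) (x : H) : H := (E.pm x).1

/-- x⁻. -/
noncomputable def minus (E : EA2Data H) (x : H) : H := (E.pm x).2

/-- s(x): the number of thick elements of H in the support of x. -/
noncomputable def sElem (E : EA2Data H) (x : H) : ℕ :=
  {y ∈ E.support x | E.hg.IsThick y}.ncard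

/-- s(G) = max {s(a) : a ∈ G}. -/
noncomputable def sSet (E : EA2Data H) (G : Set H) : ℕ :=
  sSup {k | ∃ a ∈ G, E.sElem a = k}

/-- x ⪯ y: the support of x is contained in the support of y. -/
def ple (E : EA2Data H) (x y : H) : Prop := E.support x ⊆ E.support y

/-- p♯: the number of thick elements among q_1, …, q_n. -/
noncomputable def psharp (E : EA2Data H) : ℕ := {i : Fin E.n | E.hg.IsThick (E.q i)}.ncard

end EA2Data

/-- The Gaussian binomial coefficient C(n, k)_2 with base 2, via the
q-Pascal recurrence C(n, k)_2 = C(n-1, k-1)_2 + 2^k · C(n-1, k)_2. -/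
def gaussBinom2 : ℕ → ℕ → ℕ
  | _, 0 => 1
  | 0, _ + 1 => 0
  | n + 1, k + 1 => gaussBinom2 n k + 2 ^ (k + 1) * gaussBinom2 n (k + 1)

end HyperPaper

open HyperPaper

namespace HyperPaper

namespace Hypergroup

variable (hg : Hypergroup H)

theorem e_mem_hmul_iff_right (p r : H) : hg.e ∈ hg.hmul p r ↔ r = hg.star p := by
  rw [hg.h3r, hg.idr, Set.mem_singleton_iff]

theorem e_mem_hmul_iff_left (p r : H) : hg.e ∈ hg.hmul p r ↔ p = hg.star r := by
  rw [hg.h3l, hg.idl, Set.mem_singleton_iff]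

theorem star_star (p : H) : hg.star (hg.star p) = p :=
  ((hg.e_mem_hmul_iff_left p _).1 ((hg.e_mem_hmul_iff_right p _).2 rfl)).symm

theorem smul_assoc (A B C : Set H) :
    hg.smul (hg.smul A B) C = hg.smul A (hg.smul B C) := by
  have key : ∀ a b c x, (∃ y ∈ hg.hmul a b, x ∈ hg.hmul y c) ↔
      ∃ y ∈ hg.hmul b c, x ∈ hg.hmul a y := by
    intro a b c x
    have h := Set.ext_iff.1 (hg.assoc a b c) x
    simpa only [Set.mem_iUnion, exists_prop] using h
  ext x
  constructor
  · rintro ⟨y, ⟨a, ha, b, hb, hy⟩, c, hc, hx⟩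
    obtain ⟨z, hz, hx⟩ := (key a b c x).1 ⟨y, hy, hx⟩
    exact ⟨a, ha, z, ⟨b, hb, c, hc, hz⟩, hx⟩
  · rintro ⟨a, ha, y, ⟨b, hb, c, hc, hy⟩, hx⟩
    obtain ⟨z, hz, hx⟩ := (key a b c x).2 ⟨y, hy, hx⟩
    exact ⟨z, ⟨a, ha, b, hb, hz⟩, c, hc, hx⟩

theorem e_smul (A : Set H) : hg.smul {hg.e} A = A := by
  ext x; simp [smul, hg.idl]

theorem smul_e (A : Set H) : hg.smul A {hg.e} = A := by
  ext x; simp [smul, hg.idr]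

theorem smul_singleton (a b : H) : hg.smul {a} {b} = hg.hmul a b := by
  ext x; simp [smul]

/-- The subsets of a hypergroup form a monoid under the product of subsets. -/
abbrev setMonoid : Monoid (Set H) where
  mul := hg.smul
  one := {hg.e}
  mul_assoc := hg.smul_assoc
  one_mul := hg.e_smul
  mul_one := hg.smul_e

/-- The subsets of a commutative hypergroup form a commutative monoid. -/
abbrev setCommMonoid (hcomm : ∀ p q, hg.hmul p q = hg.hmul q p) : CommMonoid (Set H) :=
  { hg.setMonoid with
    mul_comm := fun A B => by
      ext x
      constructor
      · rintro ⟨a, ha, b, hb, hx⟩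
        exact ⟨b, hb, a, ha, hcomm a b ▸ hx⟩
      · rintro ⟨a, ha, b, hb, hx⟩
        exact ⟨b, hb, a, ha, hcomm a b ▸ hx⟩ }

theorem hmul_nonempty (p q : H) : (hg.hmul p q).Nonempty := by
  have h : p ∈ hg.smul (hg.smul {p} {q}) {hg.star q} := by
    rw [hg.smul_assoc]
    refine ⟨p, rfl, hg.e, ?_, by rw [hg.idr]; rfl⟩
    rw [hg.smul_singleton]
    exact (hg.e_mem_hmul_iff_right _ _).2 rfl
  obtain ⟨y, hy, -⟩ := h
  rw [hg.smul_singleton] at hy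
  exact ⟨y, hy⟩

theorem listProd_eq_prod (l : List (Set H)) :
    hg.listProd l = (letI := hg.setMonoid; l.prod) := by
  induction l with
  | nil => rfl
  | cons a l ih => rw [listProd, ih]; rfl

theorem listProd_nonempty (l : List (Set H)) (h : ∀ A ∈ l, A.Nonempty) :
    (hg.listProd l).Nonempty := by
  induction l with
  | nil => exact ⟨hg.e, rfl⟩
  | cons A l ih =>
    obtain ⟨a, ha⟩ := h A (by simp)
    obtain ⟨b, hb⟩ := ih fun B hB => h B (by simp [hB])
    obtain ⟨x, hx⟩ := hg.hmul_nonempty a b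
    exact ⟨x, a, ha, b, hb, hx⟩

theorem e_mem_listProd (l : List (Set H)) (h : ∀ A ∈ l, hg.e ∈ A) : hg.e ∈ hg.listProd l := by
  induction l with
  | nil => rfl
  | cons A l ih =>
    exact ⟨_, h A (by simp), _, ih fun B hB => h B (by simp [hB]), by rw [hg.idl]; rfl⟩

theorem subset_listProd (l : List (Set H)) (h : ∀ A ∈ l, hg.e ∈ A) (A : Set H) (hA : A ∈ l) :
    A ⊆ hg.listProd l := by
  induction l with
  | nil => simp at hA
  | cons B l ih =>
    have h' : ∀ A ∈ l, hg.e ∈ A := fun C hC => h C (by simp [hC])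
    intro x hx
    rcases List.mem_cons.1 hA with rfl | hA
    · exact ⟨x, hx, hg.e, hg.e_mem_listProd l h', by rw [hg.idr]; rfl⟩
    · exact ⟨hg.e, h B (by simp), x, ih h' hA hx, by rw [hg.idl]; rfl⟩

theorem mem_prod_iff (hcomm : ∀ p q, hg.hmul p q = hg.hmul q p) {ι : Type*} [DecidableEq ι]
    (s : Finset ι) (S : ι → Set H) (x : H) :
    letI := hg.setCommMonoid hcomm
    x ∈ ∏ i ∈ s, S i ↔ ∃ r : ι → H, (∀ i ∈ s, r i ∈ S i) ∧ x ∈ ∏ i ∈ s, ({r i} : Set H) := by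
  let := hg.setCommMonoid hcomm
  change x ∈ ∏ i ∈ s, S i ↔ _
  induction s using Finset.induction_on generalizing x with
  | empty => exact ⟨fun hx => ⟨fun _ => x, by simp, hx⟩, fun ⟨_, _, hx⟩ => hx⟩
  | insert a s ha ih =>
    rw [Finset.prod_insert ha]
    constructor
    · rintro ⟨b, hb, c, hc, hx⟩
      obtain ⟨r, hr, hc⟩ := (ih c).1 hc
      refine ⟨Function.update r a b, ?_, ?_⟩
      · intro i hi
        rcases eq_or_ne i a with rfl | hia
        · simpa using hb
        · simpa [hia] using hr i ((Finset.mem_insert.1 hi).resolve_left hia)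
      · rw [Finset.prod_insert ha]
        refine ⟨b, by simp, c, ?_, hx⟩
        rwa [Finset.prod_congr rfl fun i hi => by
          rw [Function.update_of_ne (fun h => ha (h ▸ hi) : i ≠ a)]]
    · rintro ⟨r, hr, hx⟩
      rw [Finset.prod_insert ha] at hx
      obtain ⟨b, rfl, c, hc, hx⟩ := hx
      exact ⟨r a, hr a (by simp), c, (ih c).2 ⟨r, fun i hi => hr i (by simp [hi]), hc⟩, hx⟩

variable {hg}

theorem IsClosed.e_mem {C : Set H} (hC : hg.IsClosed C) : hg.e ∈ C := by
  obtain ⟨⟨p, hp⟩, h⟩ := hC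
  exact h ⟨_, ⟨p, hp, rfl⟩, p, hp, (hg.e_mem_hmul_iff_left _ _).2 rfl⟩

theorem IsClosed.star_mem {C : Set H} (hC : hg.IsClosed C) {p : H} (hp : p ∈ C) :
    hg.star p ∈ C :=
  hC.2 ⟨_, ⟨p, hp, rfl⟩, hg.e, hC.e_mem, by rw [hg.idr]; rfl⟩

theorem IsClosed.hmul_subset {C : Set H} (hC : hg.IsClosed C) {p q : H} (hp : p ∈ C)
    (hq : q ∈ C) : hg.hmul p q ⊆ C := fun _ hx =>
  hC.2 ⟨p, ⟨_, hC.star_mem hp, hg.star_star p⟩, q, hq, hx⟩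

theorem gen_eq_self {C : Set H} (hC : hg.IsClosed C) : hg.gen C = C :=
  Set.Subset.antisymm (Set.sInter_subset_of_mem ⟨hC, subset_rfl⟩)
    (Set.subset_sInter fun _ h => h.2)

theorem IsInvolution.gen_eq {p : H} (hp : hg.IsInvolution p) : hg.gen {p} = {hg.e, p} := by
  refine Set.Subset.antisymm (Set.sInter_subset_of_mem ⟨hp.2, by simp⟩) ?_
  refine Set.subset_sInter fun C hC => ?_
  rintro x (rfl | rfl)
  · exact hC.1.e_mem
  · exact hC.2 rfl

theorem IsInvolution.star_eq {p : H} (hp : hg.IsInvolution p) : hg.star p = p := by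
  rcases hp.2.star_mem (p := p) (by simp) with h | h
  · have := (hg.e_mem_hmul_iff_left (hg.star p) p).2 rfl
    rw [h, hg.idl] at this
    exact absurd this.symm hp.1
  · exact h

theorem IsInvolution.e_mem_sq {p : H} (hp : hg.IsInvolution p) : hg.e ∈ hg.hmul p p :=
  (hg.e_mem_hmul_iff_right _ _).2 hp.star_eq.symm

theorem IsInvolution.mem_sq_iff {p : H} (hp : hg.IsInvolution p) (x : H) :
    x ∈ hg.hmul p p ↔ x = hg.e ∨ (x = p ∧ hg.IsThick p) := by
  have hsub : hg.hmul p p ⊆ {hg.e, p} := hp.2.hmul_subset (by simp) (by simp)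
  constructor
  · intro hx
    rcases hsub hx with h | h
    · exact Or.inl h
    · refine Or.inr ⟨h, fun ht => ?_⟩
      rw [IsThin, hp.star_eq] at ht
      rw [ht] at hx
      exact hp.1 (h.symm.trans hx)
  · rintro (rfl | ⟨rfl, ht⟩)
    · exact hp.e_mem_sq
    · by_contra hx
      refine ht ?_
      rw [IsThin, hp.star_eq]
      refine Set.Subset.antisymm (fun y hy => ?_) (by simpa using hp.e_mem_sq)
      rcases hsub hy with h | h
      · exact h
      · exact absurd (h ▸ hy) hx

/-- If a subset of a hypergroup is coordinatized by the subsets of `B` in such a way that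
`x ∈ pq` means `p ∆ q ⊆ x ⊆ p ∪ q`, then its automorphisms are the permutations of `B`. -/
theorem nonempty_autGroup_mulEquiv_perm (hg : Hypergroup H) (G : Set H) {B : Type*}
    (c : G ≃ Set B) (hc : ∀ x : G, (x : H) = hg.e ↔ c x = ∅)
    (hmul_iff : ∀ p q x : G, (x : H) ∈ hg.hmul p q ↔
      c x ⊆ c p ∪ c q ∧ c p \ c q ⊆ c x ∧ c q \ c p ⊆ c x) :
    Nonempty (hg.autGroup G ≃* Equiv.Perm B) := by
  let f : Equiv.Perm B →* hg.autGroup G :=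
    { toFun := fun σ => ⟨(c.trans (Equiv.Set.congr σ)).trans c.symm, by
        refine ⟨fun x hx => ?_, fun p q x => ?_⟩
        · rw [hc] at hx ⊢
          simp [hx]
        · rw [hmul_iff, hmul_iff]
          simp [← Set.image_union, ← Set.image_sdiff σ.injective,
            Set.image_subset_image_iff σ.injective]⟩
      map_one' := by
        ext x
        simp
      map_mul' := fun σ τ => by
        ext x
        simp [Set.image_image] }
  have hf : ∀ σ x, c ((f σ).1 x) = σ '' c x := fun σ x => by simp [f]
  refine ⟨(MulEquiv.ofBijective f ⟨fun σ τ h => ?_, fun g => ?_⟩).symm⟩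
  · ext b
    have h1 := hf σ (c.symm {b})
    rw [h, hf τ] at h1
    simpa using h1.symm
  · obtain ⟨g, hg1, hg2⟩ := g
    have hle : ∀ x y : G, c x ⊆ c y ↔ (x : H) ∈ hg.hmul y y := fun x y => by
      rw [hmul_iff]; simp
    let o : Set B ≃o Set B :=
      { toEquiv := (c.symm.trans g).trans c
        map_rel_iff' := by
          intro s t
          change c (g (c.symm s)) ⊆ c (g (c.symm t)) ↔ s ⊆ t
          rw [hle, ← hg2, ← hle]
          simp }
    have hatom : ∀ b, ∃ b', o {b} = {b'} := fun b =>
      Set.isAtom_iff.1 ((OrderIso.isAtom_iff o {b}).2 (Set.isAtom_singleton b))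
    choose s hs using hatom
    have hmem : ∀ b A, s b ∈ o A ↔ b ∈ A := fun b A => by
      rw [← Set.singleton_subset_iff, ← hs, ← Set.singleton_subset_iff (a := b)]
      exact o.map_rel_iff
    have hbij : Function.Bijective s := by
      refine ⟨fun a b hab => ?_, fun b => ?_⟩
      · have : o {a} = o {b} := by rw [hs, hs, hab]
        simpa using o.injective this
      · obtain ⟨a, ha⟩ := Set.isAtom_iff.1
          ((OrderIso.isAtom_iff o.symm {b}).2 (Set.isAtom_singleton b))
        refine ⟨a, ?_⟩
        have : ({s a} : Set B) = {b} := by rw [← hs, ← ha, o.apply_symm_apply]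
        simpa using this
    refine ⟨Equiv.ofBijective s hbij, ?_⟩
    refine Subtype.ext (Equiv.ext fun x => c.injective ?_)
    rw [hf]
    have hox : o (c x) = c (g x) := by simp [o]
    ext b
    obtain ⟨a, rfl⟩ := hbij.2 b
    change _ ↔ s a ∈ c (g x)
    rw [← hox, hmem]
    simp [hbij.1.eq_iff]

end Hypergroup

namespace EA2Data

variable (E : EA2Data H)

theorem gen_q (i : Fin E.n) : E.hg.gen {E.q i} = {E.hg.e, E.q i} := (E.invol i).gen_eq

theorem gen_subset_cofactor {i j : Fin E.n} (h : i ≠ j) :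
    E.hg.gen {E.q i} ⊆ E.hg.cofactor (fun i => E.hg.gen {E.q i}) j := by
  refine E.hg.subset_listProd _ (fun A hA => ?_) _ ?_
  · obtain ⟨k, -, rfl⟩ := List.mem_map.1 hA
    simp [E.gen_q]
  · exact List.mem_map.2 ⟨i, by simpa using h, rfl⟩

theorem q_notMem_cofactor (i : Fin E.n) :
    E.q i ∉ E.hg.cofactor (fun i => E.hg.gen {E.q i}) i := fun h => by
  have : E.q i ∈ ({E.hg.e} : Set H) := by
    rw [← E.dp.2.2 i]
    exact ⟨by simp [E.gen_q], h⟩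
  exact (E.invol i).1 this

theorem q_injective : Function.Injective E.q := fun i j h => by
  by_contra hij
  refine E.q_notMem_cofactor j (E.gen_subset_cofactor hij ?_)
  simp [E.gen_q, h]

theorem hmul_q_comm_subset {i j : Fin E.n} (h : i ≠ j) :
    E.hg.hmul (E.q i) (E.q j) ⊆ E.hg.hmul (E.q j) (E.q i) := fun x hx => by
  have hx' : x ∈ E.hg.smul {E.q i} (E.hg.gen {E.q j}) :=
    ⟨_, rfl, E.q j, by simp [E.gen_q], hx⟩
  rw [← (E.dp.1 j).2.2.2 _ (Set.mem_univ _)] at hx'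
  dsimp only at hx'
  rw [E.gen_q] at hx'
  obtain ⟨b, hb, c, rfl, hxc⟩ := hx'
  rcases hb with rfl | rfl
  · rw [E.hg.idl, Set.mem_singleton_iff] at hxc
    rw [hxc, E.hg.h3r, (E.invol i).star_eq] at hx
    have := (E.invol i).2.hmul_subset (by simp) (by simp) hx
    rcases this with h' | h'
    · exact absurd h' (E.invol j).1
    · exact absurd (E.q_injective h').symm h
  · exact hxc

/-- The element of `⟨q_i⟩` singled out by the membership of `i` in `A`. -/
noncomputable def coord (A : Set (Fin E.n)) (i : Fin E.n) : H :=
  open Classical in if i ∈ A then E.q i else E.hg.e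

theorem coord_mem_gen (A : Set (Fin E.n)) (i : Fin E.n) : E.coord A i ∈ E.hg.gen {E.q i} := by
  rw [E.gen_q, coord]; split_ifs <;> simp

theorem exists_coord_eq {r : Fin E.n → H} (hr : ∀ i, r i ∈ E.hg.gen {E.q i}) :
    ∃ A, r = E.coord A := by
  refine ⟨{i | r i = E.q i}, funext fun i => ?_⟩
  have h := hr i
  rw [E.gen_q] at h
  by_cases hi : r i = E.q i
  · simp [coord, hi]
  · simpa [coord, hi] using h

theorem exists_famProd_coord (A : Set (Fin E.n)) : ∃ x, E.hg.famProd (E.coord A) = {x} := by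
  obtain ⟨x, hx⟩ : (E.hg.famProd (E.coord A)).Nonempty := by
    refine E.hg.listProd_nonempty _ fun B hB => ?_
    obtain ⟨k, -, rfl⟩ := List.mem_map.1 hB
    simp
  refine ⟨x, Set.Subset.antisymm (fun y hy => ?_) (by simpa using hx)⟩
  rw [← E.constrained x]
  exact ⟨E.coord A, ⟨E.coord_mem_gen A, hx⟩, hy⟩

/-- The product of the involutions `q_i` with `i ∈ A`. -/
noncomputable def elem (A : Set (Fin E.n)) : H := (E.exists_famProd_coord A).choose

theorem famProd_coord (A : Set (Fin E.n)) : E.hg.famProd (E.coord A) = {E.elem A} :=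
  (E.exists_famProd_coord A).choose_spec

theorem elem_surjective : Function.Surjective E.elem := fun x => by
  have hx : x ∈ E.hg.dcover (fun i => E.hg.gen {E.q i}) x := by
    rw [E.constrained x]; rfl
  obtain ⟨r, ⟨hr, hxr⟩, -⟩ := hx
  obtain ⟨A, rfl⟩ := E.exists_coord_eq hr
  rw [E.famProd_coord] at hxr
  exact ⟨A, hxr.symm⟩

theorem hmul_comm (p q : H) : E.hg.hmul p q = E.hg.hmul q p := by
  let := E.hg.setMonoid
  have hcoord : ∀ A B i j, Commute ({E.coord A i} : Set H) {E.coord B j} := by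
    intro A B i j
    change E.hg.smul _ _ = E.hg.smul _ _
    rw [E.hg.smul_singleton, E.hg.smul_singleton]
    unfold coord
    split_ifs
    · rcases eq_or_ne i j with rfl | hij
      · rfl
      · exact Set.Subset.antisymm (E.hmul_q_comm_subset hij) (E.hmul_q_comm_subset hij.symm)
    all_goals simp [E.hg.idl, E.hg.idr]
  obtain ⟨A, rfl⟩ := E.elem_surjective p
  obtain ⟨B, rfl⟩ := E.elem_surjective q
  have h : Commute ({E.elem A} : Set H) {E.elem B} := by
    rw [← E.famProd_coord, ← E.famProd_coord, Hypergroup.famProd, Hypergroup.famProd,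
      E.hg.listProd_eq_prod, E.hg.listProd_eq_prod]
    refine Commute.list_prod_left _ _ fun x hx => Commute.list_prod_right _ _ fun y hy => ?_
    obtain ⟨i, -, rfl⟩ := List.mem_map.1 hx
    obtain ⟨j, -, rfl⟩ := List.mem_map.1 hy
    exact hcoord A B i j
  rw [← E.hg.smul_singleton, ← E.hg.smul_singleton]
  exact h

/-- The commutative monoid of subsets of an elementary abelian 2-hypergroup. -/
noncomputable abbrev subsetMonoid : CommMonoid (Set H) := E.hg.setCommMonoid E.hmul_comm

theorem prod_coord (A : Set (Fin E.n)) :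
    letI := E.subsetMonoid
    ∏ i, ({E.coord A i} : Set H) = {E.elem A} := by
  let := E.subsetMonoid
  change ∏ i, ({E.coord A i} : Set H) = {E.elem A}
  rw [← E.famProd_coord, Hypergroup.famProd, E.hg.listProd_eq_prod, Fin.prod_univ_def]

theorem hmul_elem (A B : Set (Fin E.n)) :
    letI := E.subsetMonoid
    E.hg.hmul (E.elem A) (E.elem B) = ∏ i, E.hg.hmul (E.coord A i) (E.coord B i) := by
  let := E.subsetMonoid
  change E.hg.hmul (E.elem A) (E.elem B) = ∏ i, E.hg.hmul (E.coord A i) (E.coord B i)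
  have h : ∀ i, E.hg.hmul (E.coord A i) (E.coord B i)
      = ({E.coord A i} : Set H) * ({E.coord B i} : Set H) :=
    fun i => (E.hg.smul_singleton _ _).symm
  simp_rw [h]
  rw [Finset.prod_mul_distrib, E.prod_coord, E.prod_coord]
  exact (E.hg.smul_singleton _ _).symm

theorem elem_mem_prod (S : Fin E.n → Set H) (C : Set (Fin E.n)) (h : ∀ i, E.coord C i ∈ S i) :
    letI := E.subsetMonoid
    E.elem C ∈ ∏ i, S i := by
  refine (E.hg.mem_prod_iff E.hmul_comm _ _ _).2 ⟨E.coord C, fun i _ => h i, ?_⟩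
  rw [E.prod_coord]; rfl

theorem elem_empty : E.elem ∅ = E.hg.e := by
  let := E.subsetMonoid
  have h := E.prod_coord ∅
  have h' : ∀ i, ({E.coord ∅ i} : Set H) = 1 := fun i => by simp [coord]; rfl
  simp only [h', Finset.prod_const_one] at h
  exact (Set.singleton_injective h).symm

theorem e_mem_hmul_coord (A : Set (Fin E.n)) (i : Fin E.n) :
    E.hg.e ∈ E.hg.hmul (E.coord A i) (E.coord A i) := by
  unfold coord
  split_ifs
  · exact (E.invol i).e_mem_sq
  · rw [E.hg.idl]; rfl

theorem e_mem_hmul_self (x : H) : E.hg.e ∈ E.hg.hmul x x := by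
  obtain ⟨A, rfl⟩ := E.elem_surjective x
  rw [E.hmul_elem]
  have := E.elem_mem_prod (fun i => E.hg.hmul (E.coord A i) (E.coord A i)) ∅
    (fun i => by simpa [coord] using E.e_mem_hmul_coord A i)
  rwa [E.elem_empty] at this

theorem star_eq (x : H) : E.hg.star x = x :=
  ((E.hg.e_mem_hmul_iff_right x x).1 (E.e_mem_hmul_self x)).symm

theorem mem_of_elem_eq {A B : Set (Fin E.n)} (h : E.elem A = E.elem B) {i : Fin E.n}
    (hi : i ∈ A) : i ∈ B := by
  let := E.subsetMonoid
  by_contra hiB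
  have he := E.e_mem_hmul_self (E.elem A)
  nth_rw 2 [h] at he
  rw [E.hmul_elem, ← Finset.mul_prod_erase _ _ (Finset.mem_univ i)] at he
  obtain ⟨b, hb, c, hc, hbc⟩ := he
  simp only [coord, hi, hiB, if_true, if_false, E.hg.idr, Set.mem_singleton_iff] at hb
  rw [E.hg.e_mem_hmul_iff_left, E.star_eq, hb] at hbc
  refine E.q_notMem_cofactor i ?_
  rw [hbc, Hypergroup.cofactor, E.hg.listProd_eq_prod]
  obtain ⟨r, hr, hc⟩ := (E.hg.mem_prod_iff E.hmul_comm _ _ _).1 hc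
  have hc' : c ∈ ∏ j ∈ Finset.univ.erase i, E.hg.gen {E.q j} := by
    refine (E.hg.mem_prod_iff E.hmul_comm _ _ _).2 ⟨r, fun j hj => ?_, hc⟩
    refine Hypergroup.IsClosed.hmul_subset ?_ (E.coord_mem_gen A j) (E.coord_mem_gen B j) (hr j hj)
    rw [E.gen_q]
    exact (E.invol j).2
  have heq : Finset.univ.erase i =
      ((List.finRange E.n).filter fun j => decide (j ≠ i)).toFinset := by
    ext j; simp
  rw [heq, List.prod_toFinset _ ((List.nodup_finRange _).filter _)] at hc'
  exact hc'

theorem elem_injective : Function.Injective E.elem := fun _ _ h =>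
  Set.ext fun _ => ⟨E.mem_of_elem_eq h, E.mem_of_elem_eq h.symm⟩

/-- Elements of `H` correspond to the sets of indices of their supports. -/
noncomputable def supp : H ≃ Set (Fin E.n) :=
  (Equiv.ofBijective E.elem ⟨E.elem_injective, E.elem_surjective⟩).symm

theorem supp_elem (A : Set (Fin E.n)) : E.supp (E.elem A) = A :=
  Equiv.ofBijective_symm_apply_apply E.elem _ A

theorem supp_e : E.supp E.hg.e = ∅ := by rw [← E.elem_empty, supp_elem]

/-- The indices of the thick involutions. -/
def thickIdx : Set (Fin E.n) := {i | E.hg.IsThick (E.q i)}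

theorem coord_mem_hmul_coord (A B C : Set (Fin E.n)) (i : Fin E.n) :
    E.coord C i ∈ E.hg.hmul (E.coord A i) (E.coord B i) ↔
      (i ∈ C → i ∈ A ∨ i ∈ B) ∧ (i ∈ C → i ∈ A → i ∈ B → i ∈ E.thickIdx) ∧
        (i ∈ A → i ∉ B → i ∈ C) ∧ (i ∈ B → i ∉ A → i ∈ C) := by
  have h := (E.invol i).1
  by_cases hA : i ∈ A <;> by_cases hB : i ∈ B <;> by_cases hC : i ∈ C <;>
    simp [coord, hA, hB, hC, E.hg.idl, E.hg.idr, h, h.symm, (E.invol i).mem_sq_iff, thickIdx]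

theorem mem_hmul_iff (x y z : H) : x ∈ E.hg.hmul y z ↔
    E.supp x ⊆ E.supp y ∪ E.supp z ∧ E.supp x ∩ E.supp y ∩ E.supp z ⊆ E.thickIdx ∧
      E.supp y \ E.supp z ⊆ E.supp x ∧ E.supp z \ E.supp y ⊆ E.supp x := by
  obtain ⟨C, rfl⟩ := E.elem_surjective x
  obtain ⟨A, rfl⟩ := E.elem_surjective y
  obtain ⟨B, rfl⟩ := E.elem_surjective z
  have key : E.elem C ∈ E.hg.hmul (E.elem A) (E.elem B) ↔
      ∀ i, E.coord C i ∈ E.hg.hmul (E.coord A i) (E.coord B i) := by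
    rw [E.hmul_elem]
    refine ⟨fun h => ?_, E.elem_mem_prod _ C⟩
    obtain ⟨r, hr, h⟩ := (E.hg.mem_prod_iff E.hmul_comm _ _ _).1 h
    obtain ⟨D, rfl⟩ : ∃ D, r = E.coord D := by
      refine E.exists_coord_eq fun i => ?_
      refine Hypergroup.IsClosed.hmul_subset ?_ (E.coord_mem_gen A i) (E.coord_mem_gen B i)
        (hr i (Finset.mem_univ i))
      rw [E.gen_q]
      exact (E.invol i).2
    rw [E.prod_coord] at h
    rw [E.elem_injective h]
    exact fun i => hr i (Finset.mem_univ i)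
  simp only [key, supp_elem, coord_mem_hmul_coord, forall_and, Set.subset_def, Set.mem_union,
    Set.mem_inter_iff, Set.mem_sdiff, and_imp]

theorem support_eq (x : H) : E.support x = E.q '' E.supp x := by
  obtain ⟨A, rfl⟩ := E.elem_surjective x
  rw [supp_elem]
  ext y
  constructor
  · rintro ⟨hy, r, ⟨hr, hx⟩, i, rfl⟩
    obtain ⟨B, rfl⟩ := E.exists_coord_eq hr
    rw [E.famProd_coord] at hx
    rw [E.elem_injective hx]
    by_cases hi : i ∈ B
    · exact ⟨i, hi, by simp [coord, hi]⟩
    · exact absurd (by simp [coord, hi]) hy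
  · rintro ⟨i, hi, rfl⟩
    refine ⟨(E.invol i).1, E.coord A, ⟨E.coord_mem_gen A, by rw [famProd_coord]; rfl⟩, i, ?_⟩
    simp [coord, hi]

theorem sElem_eq (x : H) : E.sElem x = (E.supp x ∩ E.thickIdx).ncard := by
  rw [sElem, support_eq, ← Set.ncard_image_of_injective _ E.q_injective]
  congr 1
  ext y
  constructor
  · rintro ⟨⟨i, hi, rfl⟩, h⟩
    exact ⟨i, ⟨hi, h⟩, rfl⟩
  · rintro ⟨i, ⟨hi, h⟩, rfl⟩
    exact ⟨⟨i, hi, rfl⟩, h⟩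

theorem supp_subset_of_mem_thickIn {G : Set H} {r : H} (hr : r ∈ E.ThickIn G) :
    E.supp r ⊆ E.thickIdx := by
  rcases hr.2 with rfl | h
  · simp [supp_e]
  · intro i hi
    exact h _ (by rw [support_eq]; exact ⟨i, hi, rfl⟩)

theorem isClosed_iff (F : Set H) :
    E.hg.IsClosed F ↔ F.Nonempty ∧ ∀ x ∈ F, ∀ y ∈ F, E.hg.hmul x y ⊆ F := by
  refine ⟨fun h => ⟨h.1, fun x hx y hy => h.hmul_subset hx hy⟩, fun h => ⟨h.1, ?_⟩⟩
  rintro z ⟨_, ⟨x, hx, rfl⟩, y, hy, hz⟩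
  rw [E.star_eq] at hz
  exact h.2 x hx y hy hz

theorem isClosed_supp_subset (B : Set (Fin E.n)) : E.hg.IsClosed {x | E.supp x ⊆ B} := by
  rw [isClosed_iff]
  refine ⟨⟨E.hg.e, by simp [supp_e]⟩, fun x hx y hy z hz => ?_⟩
  exact ((E.mem_hmul_iff _ _ _).1 hz).1.trans (Set.union_subset hx hy)

theorem mem_hmul_self_iff (x y : H) :
    x ∈ E.hg.hmul y y ↔ E.supp x ⊆ E.supp y ∩ E.thickIdx := by
  rw [mem_hmul_iff]
  simp only [Set.subset_def, Set.mem_union, Set.mem_inter_iff, Set.mem_sdiff]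
  grind

theorem nonempty_autGroup_supp_subset {B : Set (Fin E.n)} (hB : B ⊆ E.thickIdx) {k : ℕ}
    (hk : B.ncard = k) :
    Nonempty (E.hg.autGroup {x | E.supp x ⊆ B} ≃* Equiv.Perm (Fin k)) := by
  let c : {x | E.supp x ⊆ B} ≃ Set B :=
    { toFun := fun x => Subtype.val ⁻¹' E.supp x
      invFun := fun s => ⟨E.elem (Subtype.val '' s), by simp [supp_elem]⟩
      left_inv := fun x => Subtype.ext (E.supp.injective (by
        have hx : E.supp x ⊆ B := x.2
        rw [supp_elem, Subtype.image_preimage_coe, Set.inter_eq_right.2 hx]))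
      right_inv := fun s => by simp [supp_elem, Set.preimage_image_eq _ Subtype.val_injective] }
  have hsub : ∀ (s : Set (Fin E.n)) (t : Set (Fin E.n)), s ⊆ B →
      ((Subtype.val ⁻¹' s : Set B) ⊆ Subtype.val ⁻¹' t ↔ s ⊆ t) := fun s t hs =>
    ⟨fun h i hi => h (a := ⟨i, hs hi⟩) hi, fun h => Set.preimage_mono h⟩
  obtain ⟨f⟩ := E.hg.nonempty_autGroup_mulEquiv_perm {x | E.supp x ⊆ B} c
    (fun x => by
      rw [← Set.subset_empty_iff]
      change _ ↔ Subtype.val ⁻¹' E.supp x ⊆ (Subtype.val ⁻¹' (∅ : Set (Fin E.n)) : Set B)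
      rw [hsub _ _ x.2, Set.subset_empty_iff, ← E.supp_e, E.supp.injective.eq_iff])
    (fun p q x => by
      change _ ↔ Subtype.val ⁻¹' E.supp x ⊆
          (Subtype.val ⁻¹' (E.supp p ∪ E.supp q) : Set B) ∧
        Subtype.val ⁻¹' (E.supp p \ E.supp q) ⊆ (Subtype.val ⁻¹' E.supp x : Set B) ∧
        Subtype.val ⁻¹' (E.supp q \ E.supp p) ⊆ (Subtype.val ⁻¹' E.supp x : Set B)
      rw [hsub _ _ x.2, hsub _ _ (Set.sdiff_subset.trans p.2),
        hsub _ _ (Set.sdiff_subset.trans q.2), mem_hmul_iff]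
      have : E.supp x ∩ E.supp p ∩ E.supp q ⊆ E.thickIdx :=
        fun i hi => hB (x.2 hi.1.1)
      tauto)
  have e : B ≃ Fin k := Finite.equivFinOfCardEq hk
  exact ⟨f.trans e.permCongrHom⟩

theorem gen_singleton_eq {r : H} (hr : E.supp r ⊆ E.thickIdx) :
    E.hg.gen {r} = {x | E.supp x ⊆ E.supp r} := by
  refine Set.Subset.antisymm
    (Set.sInter_subset_of_mem ⟨E.isClosed_supp_subset _, by simp⟩) ?_
  refine Set.subset_sInter fun C hC x hx => ?_
  have hrC : r ∈ C := hC.2 rfl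
  exact hC.1.hmul_subset hrC hrC ((E.mem_hmul_self_iff _ _).2 (Set.subset_inter hx (hx.trans hr)))

/-- The indices of the thick involutions occurring in the supports of elements of `G`. -/
def thickIdxIn (G : Set H) : Set (Fin E.n) := (⋃ x ∈ G, E.supp x) ∩ E.thickIdx

/-- A closed subset containing all squares `xx` with `x ∈ G` contains every element that is
supported on thick involutions occurring in `G`. -/
theorem supp_subset_thickIdxIn_subset {F G : Set H} (hF : E.hg.IsClosed F)
    (h : ∀ x ∈ G, E.hg.hmul x x ⊆ F) : {x | E.supp x ⊆ E.thickIdxIn G} ⊆ F := by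
  have key : ∀ A : Set (Fin E.n), A.Finite → A ⊆ E.thickIdxIn G → E.elem A ∈ F := by
    intro A hA
    induction A, hA using Set.Finite.induction_on with
    | empty => intro _; rw [elem_empty]; exact hF.e_mem
    | @insert i A hi _ ih =>
      intro hsub
      rw [Set.insert_subset_iff] at hsub
      obtain ⟨x, hx, hix⟩ := Set.mem_iUnion₂.1 hsub.1.1
      have h1 : E.elem {i} ∈ F := h x hx ((E.mem_hmul_self_iff _ _).2 (by
        rw [supp_elem, Set.singleton_subset_iff]
        exact ⟨hix, hsub.1.2⟩))
      refine hF.hmul_subset h1 (ih hsub.2) ((E.mem_hmul_iff _ _ _).2 ?_)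
      simp only [supp_elem, Set.subset_def, Set.mem_union, Set.mem_inter_iff, Set.mem_sdiff,
        Set.mem_insert_iff, Set.mem_singleton_iff]
      grind
  intro x hx
  obtain ⟨A, rfl⟩ := E.elem_surjective x
  rw [Set.mem_ofPred_eq, supp_elem] at hx
  exact key A (Set.toFinite A) hx

theorem Osup_eq {G : Set H} (hG : E.hg.IsClosed G) :
    E.hg.Osup G = {x | E.supp x ⊆ E.thickIdxIn G} := by
  rw [Hypergroup.Osup, Hypergroup.gen_eq_self hG]
  refine Set.Subset.antisymm (Set.sInter_subset_of_mem ?_) ?_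
  · refine ⟨E.isClosed_supp_subset _, hG,
      E.supp_subset_thickIdxIn_subset hG fun x hx => hG.hmul_subset hx hx, ?_⟩
    rintro p hp x ⟨y, ⟨p', rfl, z, hz, hy⟩, p'', rfl, hx⟩
    rw [E.star_eq] at hy
    have h1 := (E.mem_hmul_iff _ _ _).1 hy
    have h2 := (E.mem_hmul_iff _ _ _).1 hx
    have hp' : E.supp p'' ⊆ ⋃ x ∈ G, E.supp x := Set.subset_biUnion_of_mem hp
    rw [Set.mem_ofPred_eq, thickIdxIn] at hz ⊢
    simp only [Set.subset_def, Set.mem_union, Set.mem_inter_iff, Set.mem_sdiff] at h1 h2 hz hp' ⊢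
    grind
  · refine Set.subset_sInter fun F hF => E.supp_subset_thickIdxIn_subset hF.1 fun x hx y hy => ?_
    refine hF.2.2.2 x hx ⟨x, ⟨_, rfl, _, hF.1.e_mem, ?_⟩, x, rfl, hy⟩
    rw [E.hg.idr, E.star_eq]
    rfl

theorem sSet_eq {G : Set H} (hG : E.hg.IsClosed G) : E.sSet G = (E.thickIdxIn G).ncard := by
  refine IsGreatest.csSup_eq ⟨⟨E.elem (E.thickIdxIn G), ?_, ?_⟩, ?_⟩
  · refine E.supp_subset_thickIdxIn_subset hG (fun x hx => hG.hmul_subset hx hx) ?_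
    rw [Set.mem_ofPred_eq, supp_elem]
  · rw [sElem_eq, supp_elem, thickIdxIn, Set.inter_assoc, Set.inter_self]
  · rintro _ ⟨a, ha, rfl⟩
    rw [sElem_eq]
    exact Set.ncard_le_ncard
      (Set.inter_subset_inter_left _ (Set.subset_biUnion_of_mem (u := fun x => E.supp x) ha))

theorem thickIdxIn_univ : E.thickIdxIn Set.univ = E.thickIdx := by
  refine Set.inter_eq_right.2 fun i _ => Set.mem_iUnion₂.2 ⟨E.elem {i}, trivial, ?_⟩
  rw [supp_elem]
  rfl

end EA2Data

end HyperPaper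

/-- For a closed subset G of an elementary abelian 2-hypergroup H and
r ∈ Thick(G): Aut(⟨r⟩) ≅ S_{s(r)} and Aut(O^ϑ(G)) ≅ S_{s(G)}; in particular
Aut(O^ϑ(H)) ≅ S_{p♯}. -/
theorem stmt18 {H : Type*} (E : EA2Data H) (G : Set H) (hG : E.hg.IsClosed G)
    (r : H) (hr : r ∈ E.ThickIn G) :
    Nonempty ((E.hg.autGroup (E.hg.gen {r})) ≃* Equiv.Perm (Fin (E.sElem r))) ∧
    Nonempty ((E.hg.autGroup (E.hg.Osup G)) ≃* Equiv.Perm (Fin (E.sSet G))) ∧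
    Nonempty ((E.hg.autGroup (E.hg.Osup (Set.univ : Set H))) ≃*
      Equiv.Perm (Fin E.psharp)) := by
  refine ⟨?_, ?_, ?_⟩
  · have h := E.supp_subset_of_mem_thickIn hr
    rw [E.gen_singleton_eq h]
    exact E.nonempty_autGroup_supp_subset h (by rw [E.sElem_eq, Set.inter_eq_left.2 h])
  · rw [E.Osup_eq hG]
    exact E.nonempty_autGroup_supp_subset Set.inter_subset_right (E.sSet_eq hG).symm
  · have huniv : E.hg.IsClosed Set.univ := ⟨⟨E.hg.e, trivial⟩, Set.subset_univ _⟩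
    rw [E.Osup_eq huniv, E.thickIdxIn_univ]
    exact E.nonempty_autGroup_supp_subset subset_rfl rfl
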